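/- Assume (P1), let u ∈ L_{sp(x,·)}, let x ∈ ℝ^N \ {0}, and let a ∈ ℝ. Then ∫_{{y ∈ ℝ^N : |x−y| > 1}} |a − u(y)|^{p(x,y)−1} / |x−y|^{N+s·p(x,y)} dy < ∞. -/

import Mathlib

open MeasureTheory Filter Set

lemma abs_sub_rpow_le {a b q Q : ℝ} (hq : 0 ≤ q) (hqQ : q ≤ Q) :
    |a - b| ^ q ≤ 2 ^ Q * ((1 + |a|) ^ Q + |b| ^ q) := by
  have hmax : |a - b| ≤ 2 * max |a| |b| := by
    have := abs_sub a b
    linarith [le_max_left |a| |b|, le_max_right |a| |b|]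
  have hm0 : 0 ≤ max |a| |b| := (abs_nonneg a).trans (le_max_left _ _)
  have ha : |a| ^ q ≤ (1 + |a|) ^ Q :=
    (Real.rpow_le_rpow (abs_nonneg a) (by linarith) hq).trans
      (Real.rpow_le_rpow_of_exponent_le (by linarith [abs_nonneg a]) hqQ)
  have ha0 : 0 ≤ (1 + |a|) ^ Q := by positivity
  have hb0 : 0 ≤ |b| ^ q := by positivity
  calc |a - b| ^ q ≤ (2 * max |a| |b|) ^ q := Real.rpow_le_rpow (abs_nonneg _) hmax hq
    _ = 2 ^ q * max |a| |b| ^ q := Real.mul_rpow (by norm_num) hm0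
    _ ≤ 2 ^ Q * ((1 + |a|) ^ Q + |b| ^ q) := by
      gcongr
      · norm_num
      · rcases max_choice |a| |b| with h | h <;> rw [h] <;> linarith

lemma one_div_norm_sub_rpow_le {E : Type*} [SeminormedAddCommGroup E] {x y : E} {r R : ℝ}
    (hr : 0 ≤ r) (hrR : r ≤ R) (hxy : 1 < ‖x - y‖) :
    1 / ‖x - y‖ ^ r ≤ (1 + (1 + ‖x‖) ^ R) * (1 / (1 + ‖y‖ ^ r)) := by
  have hy : ‖y‖ ≤ (1 + ‖x‖) * ‖x - y‖ := by
    have h : ‖y‖ ≤ ‖x‖ + ‖x - y‖ := by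
      simpa using norm_sub_le x (x - y)
    nlinarith [norm_nonneg x]
  have hd : 1 ≤ ‖x - y‖ ^ r := Real.one_le_rpow hxy.le hr
  have hyr : ‖y‖ ^ r ≤ (1 + ‖x‖) ^ R * ‖x - y‖ ^ r :=
    calc ‖y‖ ^ r ≤ ((1 + ‖x‖) * ‖x - y‖) ^ r := Real.rpow_le_rpow (norm_nonneg _) hy hr
      _ = (1 + ‖x‖) ^ r * ‖x - y‖ ^ r := Real.mul_rpow (by positivity) (norm_nonneg _)
      _ ≤ _ := by
        gcongr
        linarith [norm_nonneg x]
  rw [mul_one_div, div_le_div_iff₀ (by linarith) (by positivity)]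
  linarith

lemma one_div_rpow_le_one_add_rpow_neg {t r l : ℝ} (ht : 1 < t) (hl : 0 ≤ l) (hlr : l ≤ r) :
    1 / t ^ r ≤ 2 ^ l * (1 + t) ^ (-l) := by
  have h : (1 + t) ^ l ≤ 2 ^ l * t ^ r :=
    calc (1 + t) ^ l ≤ (2 * t) ^ l := Real.rpow_le_rpow (by linarith) (by linarith) hl
      _ = 2 ^ l * t ^ l := Real.mul_rpow (by norm_num) (by linarith)
      _ ≤ _ := by
        gcongr
        exact ht.le
  rw [Real.rpow_neg (by linarith), ← div_eq_mul_inv, div_le_div_iff₀ (by positivity) (by positivity)]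
  linarith



theorem stmt12 (N : ℕ) [NeZero N] (s : ℝ) (hs0 : 0 < s) (hs1 : s < 1)
    (p : EuclideanSpace ℝ (Fin N) → EuclideanSpace ℝ (Fin N) → ℝ)
    (pminus pplus m : ℝ)
    -- (P1)
    (hp_cont : Continuous (fun z : EuclideanSpace ℝ (Fin N) × EuclideanSpace ℝ (Fin N) => p z.1 z.2))
    (hp2 : ∀ x y, 2 < p x y)
    (hpmin : ∀ x y, pminus ≤ p x y) (hpmin_att : ∃ x y, p x y = pminus)
    (hpmax : ∀ x y, p x y ≤ pplus) (hpmax_att : ∃ x y, p x y = pplus)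
    (hm0 : 0 < m) (hm1 : m < 1) (hmlog : 1 - 1 / Real.log m < pminus)
    (hspN : s * pplus < N)
    -- u ∈ L_{sp(x,·)}
    (u : EuclideanSpace ℝ (Fin N) → ℝ)
    (hu_loc : LocallyIntegrable u)
    (hu_Lsp : ∀ x, Integrable (fun y : EuclideanSpace ℝ (Fin N) =>
        |u y| ^ (p x y - 1) / (1 + ‖y‖ ^ ((N : ℝ) + s * p x y))))
    (x : EuclideanSpace ℝ (Fin N)) (hx : x ≠ 0) (a : ℝ) :
    ∫⁻ y in {y : EuclideanSpace ℝ (Fin N) | 1 < ‖x - y‖},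
        ENNReal.ofReal (|a - u y| ^ (p x y - 1) / ‖x - y‖ ^ ((N : ℝ) + s * p x y)) < ⊤ := by
  have hQ : ∀ y, p x y - 1 ≤ pplus := fun y => by linarith [hpmax x y]
  set C : ℝ := 1 + (1 + ‖x‖) ^ ((N : ℝ) + s * pplus)
  have hint : Integrable (fun y : EuclideanSpace ℝ (Fin N) =>
      (1 + ‖x - y‖) ^ (-((N : ℝ) + s))) := by
    have h : Integrable (fun y : EuclideanSpace ℝ (Fin N) => (1 + ‖y‖) ^ (-((N : ℝ) + s))) :=
      integrable_one_add_norm (by simpa using hs0)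
    exact h.comp_sub_left x
  have hG := ((hint.const_mul (2 ^ ((N : ℝ) + s))).const_mul ((1 + |a|) ^ pplus)).add
    ((hu_Lsp x).const_mul C) |>.const_mul (2 ^ pplus)
  refine lt_of_le_of_lt ?_ hG.lintegral_lt_top
  refine (setLIntegral_mono' (measurableSet_lt measurable_const (by fun_prop))
    fun y hy => ENNReal.ofReal_le_ofReal ?_).trans (setLIntegral_le_lintegral _ _)
  have hy : 1 < ‖x - y‖ := hy
  have hN : (0 : ℝ) ≤ N := Nat.cast_nonneg N
  have hp := hp2 x y
  have hle : (N : ℝ) + s ≤ N + s * p x y := by nlinarith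
  have h1 := abs_sub_rpow_le (a := a) (b := u y) (by linarith : 0 ≤ p x y - 1) (hQ y)
  have h2 : 1 / ‖x - y‖ ^ ((N : ℝ) + s * p x y) ≤ C * (1 / (1 + ‖y‖ ^ ((N : ℝ) + s * p x y))) :=
    one_div_norm_sub_rpow_le (by linarith)
      (by linarith [mul_le_mul_of_nonneg_left (hpmax x y) hs0.le]) hy
  have h3 := one_div_rpow_le_one_add_rpow_neg hy (by linarith : 0 ≤ (N : ℝ) + s) hle
  simp only [Pi.add_apply]
  calc |a - u y| ^ (p x y - 1) / ‖x - y‖ ^ ((N : ℝ) + s * p x y)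
      ≤ 2 ^ pplus * ((1 + |a|) ^ pplus + |u y| ^ (p x y - 1)) /
          ‖x - y‖ ^ ((N : ℝ) + s * p x y) := by gcongr
    _ = 2 ^ pplus * ((1 + |a|) ^ pplus * (1 / ‖x - y‖ ^ ((N : ℝ) + s * p x y)) +
          |u y| ^ (p x y - 1) * (1 / ‖x - y‖ ^ ((N : ℝ) + s * p x y))) := by ring
    _ ≤ 2 ^ pplus * ((1 + |a|) ^ pplus * (2 ^ ((N : ℝ) + s) * (1 + ‖x - y‖) ^ (-((N : ℝ) + s))) +
          |u y| ^ (p x y - 1) * (C * (1 / (1 + ‖y‖ ^ ((N : ℝ) + s * p x y))))) := by gcongr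
    _ = _ := by ring
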